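/- Let X ⊆ ℝ^m_{≥0} be a nonempty convex set and let λ ∈ X be decreasingly minimal in X. Suppose the maximum entry of λ is attained at a unique coordinate r*, i.e., λ_{r*} = ‖λ‖_∞ and λ_i < ‖λ‖_∞ for all i ≠ r*. Then x_{r*} ≥ λ_{r*} for every x ∈ X; in particular, inf_{x∈X} x_{r*} = λ_{r*}. -/

import Mathlib

open scoped BigOperators

/-- The vector `x` with its entries sorted in decreasing order. -/
noncomputable def sortDesc {m : ℕ} (x : Fin m → ℝ) : Fin m → ℝ :=
  fun i => -(((fun j => -x j) ∘ (Tuple.sort fun j => -x j)) i)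

/-- The decreasing preorder: `x ≤_dec y`. -/
def decLE {m : ℕ} (x y : Fin m → ℝ) : Prop :=
  sortDesc x = sortDesc y ∨
    ∃ k : Fin m, sortDesc x k < sortDesc y k ∧
      ∀ j : Fin m, j < k → sortDesc x j = sortDesc y j

theorem decLE_max {m : ℕ} {x y : Fin m → ℝ} (h : decLE x y) (i : Fin m) :
    ∃ j, x i ≤ y j := by
  have hm : 0 < m := i.pos
  let z : Fin m := ⟨0, hm⟩
  have hx : x i ≤ sortDesc x z := by
    have hmono := Tuple.monotone_sort (fun j => -x j)
    have h1 : z ≤ (Tuple.sort fun j => -x j).symm i := Fin.mk_le_of_le_val (Nat.zero_le _)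
    have h2 := hmono h1
    simp only [Function.comp, Equiv.apply_symm_apply] at h2
    simp only [sortDesc, Function.comp]
    linarith
  have hz : sortDesc x z ≤ sortDesc y z := by
    rcases h with h | ⟨k, hk, hj⟩
    · rw [h]
    · by_cases hzk : z = k
      · rw [hzk]; exact hk.le
      · have : z ≤ k := Fin.mk_le_of_le_val (Nat.zero_le _)
        exact (hj z (lt_of_le_of_ne this hzk)).le
  refine ⟨Tuple.sort (fun j => -y j) z, ?_⟩
  have h3 : sortDesc y z = y (Tuple.sort (fun j => -y j) z) := by
    simp [sortDesc]
  linarith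

/-- If `λ` is decreasingly minimal in a nonempty convex `X ⊆ ℝ^m_{≥0}`
and its maximum entry is attained at a unique coordinate `r*`, then every `x ∈ X`
satisfies `x_{r*} ≥ λ_{r*}`; in particular `inf_{x∈X} x_{r*} = λ_{r*}`. -/
theorem stmt_19 (m : ℕ)
    (X : Set (Fin m → ℝ)) (hne : X.Nonempty) (hcv : Convex ℝ X)
    (hpos : ∀ x ∈ X, ∀ i, 0 ≤ x i)
    (lam : Fin m → ℝ) (hlamX : lam ∈ X) (hdm : ∀ y ∈ X, decLE lam y)
    (rs : Fin m) (hmax : lam rs = ‖lam‖)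
    (huniq : ∀ i, i ≠ rs → lam i < ‖lam‖) :
    (∀ x ∈ X, lam rs ≤ x rs) ∧ (⨅ x : X, (x : Fin m → ℝ) rs) = lam rs := by
  have key : ∀ x ∈ X, lam rs ≤ x rs := by
    intro x hx
    by_contra! hlt
    have hev : ∀ᶠ t : ℝ in nhdsWithin 0 (Set.Ioi 0),
        ∀ i, (1 - t) * lam i + t * x i < lam rs := by
      rw [Filter.eventually_all]
      intro i
      by_cases hi : i = rs
      · subst hi
        filter_upwards [self_mem_nhdsWithin] with t ht
        have ht' : 0 < t := ht
        nlinarith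
      · have hc : Continuous fun t : ℝ => (1 - t) * lam i + t * x i := by fun_prop
        have h0 : (1 - (0 : ℝ)) * lam i + 0 * x i < lam rs := by
          rw [hmax]; simpa using huniq i hi
        exact nhdsWithin_le_nhds (hc.continuousAt.eventually_lt continuousAt_const h0)
    have h1 : ∀ᶠ t : ℝ in nhdsWithin 0 (Set.Ioi 0), t < 1 :=
      nhdsWithin_le_nhds (eventually_lt_nhds one_pos)
    obtain ⟨t, ⟨ht, ht1⟩, ht0⟩ := ((hev.and h1).and self_mem_nhdsWithin).exists
    have ht0' : 0 < t := ht0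
    have hy := hcv hlamX hx (by linarith : 0 ≤ 1 - t) ht0'.le (by ring)
    obtain ⟨j, hj⟩ := decLE_max (hdm _ hy) rs
    have := ht j
    simp only [Pi.add_apply, Pi.smul_apply, smul_eq_mul] at hj
    linarith
  refine ⟨key, le_antisymm ?_ ?_⟩
  · exact ciInf_le (f := fun x : X => (x : Fin m → ℝ) rs)
      ⟨lam rs, by rintro _ ⟨x, rfl⟩; exact key x x.2⟩ ⟨lam, hlamX⟩
  · haveI : Nonempty X := ⟨⟨lam, hlamX⟩⟩
    exact le_ciInf fun x => key x x.2
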